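/- arXiv:2502.10009 — 3 statements merged into one kernel-verified Lean document; each statement's English description precedes it below -/
import Mathlib

section
/- Let χ : ℝ³ → ℝ³ be twice continuously differentiable and v : ℝ³ → ℝ³ continuously differentiable. Let F(x) be the Jacobian matrix of χ at x (entries F(x)_{kl} = ∂_l χ_k(x)) and define the Piola transform P(x) := adj(F(x)) · v(χ(x)), where adj is the adjugate matrix. Then div P(x) = det(F(x)) · (div v)(χ(x)) for every x ∈ ℝ³. In particular, if div v ≡ 0 then div P ≡ 0. -/
/-- The cyclic cofactor formula for the adjugate of a `3 × 3` matrix. -/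
theorem adjugate_fin_three_apply {R : Type*} [CommRing R] (A : Matrix (Fin 3) (Fin 3) R)
    (i j : Fin 3) :
    A.adjugate i j =
      A (j + 1) (i + 1) * A (j + 2) (i + 2) - A (j + 1) (i + 2) * A (j + 2) (i + 1) := by
  rw [Matrix.adjugate_fin_three]
  fin_cases i <;> fin_cases j <;> simp [Fin.reduceAdd] <;> ring

/-- The product rule for a component of `adj(F) w`. -/
theorem hasFDerivAt_adjugate_mulVec_apply {E : Type*} [NormedAddCommGroup E] [NormedSpace ℝ E]
    {F : E → Matrix (Fin 3) (Fin 3) ℝ} {F' : Fin 3 → Fin 3 → E →L[ℝ] ℝ}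
    {w : E → Fin 3 → ℝ} {w' : Fin 3 → E →L[ℝ] ℝ} {x : E}
    (hF : ∀ k l, HasFDerivAt (fun y => F y k l) (F' k l) x)
    (hw : ∀ j, HasFDerivAt (fun y => w y j) (w' j) x) (i : Fin 3) :
    HasFDerivAt (fun y => ((F y).adjugate.mulVec (w y)) i)
      (∑ j, ((F x (j + 1) (i + 1) * F x (j + 2) (i + 2)
            - F x (j + 1) (i + 2) * F x (j + 2) (i + 1)) • w' j
          + w x j • ((F x (j + 1) (i + 1) • F' (j + 2) (i + 2)
              + F x (j + 2) (i + 2) • F' (j + 1) (i + 1))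
            - (F x (j + 1) (i + 2) • F' (j + 2) (i + 1)
              + F x (j + 2) (i + 1) • F' (j + 1) (i + 2))))) x := by
  simp only [Matrix.mulVec, dotProduct, adjugate_fin_three_apply]
  exact HasFDerivAt.fun_sum fun j _ =>
    (((hF _ _).mul (hF _ _)).sub ((hF _ _).mul (hF _ _))).mul (hw j)

/-- The divergence of `adj(F) w` when the rows of `F` are curl-free and the derivative of `w`
factors through `F`. -/
theorem sum_fderiv_adjugate_mulVec
    {F : (Fin 3 → ℝ) → Matrix (Fin 3) (Fin 3) ℝ} {F' : Fin 3 → Fin 3 → (Fin 3 → ℝ) →L[ℝ] ℝ}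
    {w : (Fin 3 → ℝ) → Fin 3 → ℝ} {w' : Fin 3 → (Fin 3 → ℝ) →L[ℝ] ℝ} {x : Fin 3 → ℝ}
    (hF : ∀ k l, HasFDerivAt (fun y => F y k l) (F' k l) x)
    (hw : ∀ j, HasFDerivAt (fun y => w y j) (w' j) x)
    (hsymm : ∀ k l m, F' k l (Pi.single m 1) = F' k m (Pi.single l 1))
    (G : Matrix (Fin 3) (Fin 3) ℝ)
    (hG : ∀ j i, w' j (Pi.single i 1) = ∑ k, F x k i * G j k) :
    ∑ i, fderiv ℝ (fun y => (F y).adjugate.mulVec (w y)) x (Pi.single i 1) i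
      = (F x).det * ∑ i, G i i := by
  rw [(hasFDerivAt_pi.2 (hasFDerivAt_adjugate_mulVec_apply hF hw)).fderiv]
  simp only [ContinuousLinearMap.coe_pi', add_apply, sub_apply, smul_apply, smul_eq_mul, hG,
    Matrix.det_fin_three, Fin.sum_univ_three, Fin.reduceAdd]
  simp only [fun k => hsymm k 1 0, fun k => hsymm k 2 0, fun k => hsymm k 2 1]
  ring

theorem stmt_4 (χ v : (Fin 3 → ℝ) → (Fin 3 → ℝ))
    (hχ : ContDiff ℝ 2 χ) (hv : ContDiff ℝ 1 v) :
    (∀ x : Fin 3 → ℝ,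
        ∑ i : Fin 3,
          fderiv ℝ
            (fun y =>
              Matrix.mulVec
                (Matrix.adjugate (Matrix.of fun k l => fderiv ℝ χ y (Pi.single l 1) k))
                (v (χ y)))
            x (Pi.single i 1) i
          = (Matrix.of fun k l => fderiv ℝ χ x (Pi.single l 1) k).det *
              ∑ i : Fin 3, fderiv ℝ v (χ x) (Pi.single i 1) i) ∧
      ((∀ y : Fin 3 → ℝ, ∑ i : Fin 3, fderiv ℝ v y (Pi.single i 1) i = 0) →
        ∀ x : Fin 3 → ℝ,
          ∑ i : Fin 3,
            fderiv ℝ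
              (fun y =>
                Matrix.mulVec
                  (Matrix.adjugate (Matrix.of fun k l => fderiv ℝ χ y (Pi.single l 1) k))
                  (v (χ y)))
              x (Pi.single i 1) i = 0) := by
  have key : ∀ x : Fin 3 → ℝ,
      ∑ i : Fin 3,
        fderiv ℝ
          (fun y =>
            Matrix.mulVec
              (Matrix.adjugate (Matrix.of fun k l => fderiv ℝ χ y (Pi.single l 1) k))
              (v (χ y)))
          x (Pi.single i 1) i
        = (Matrix.of fun k l => fderiv ℝ χ x (Pi.single l 1) k).det *
            ∑ i : Fin 3, fderiv ℝ v (χ x) (Pi.single i 1) i := by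
    intro x
    have hχ' : HasFDerivAt (fderiv ℝ χ) (fderiv ℝ (fderiv ℝ χ) x) x :=
      ((hχ.fderiv_right (m := 1) (by norm_num)).differentiable (by norm_num) x).hasFDerivAt
    have hw : HasFDerivAt (fun y => v (χ y)) ((fderiv ℝ v (χ x)).comp (fderiv ℝ χ x)) x :=
      (hv.differentiable (by norm_num) (χ x)).hasFDerivAt.comp x
        (hχ.differentiable (by norm_num) x).hasFDerivAt
    have hsymm : IsSymmSndFDerivAt ℝ χ x :=
      hχ.contDiffAt.isSymmSndFDerivAt (by simp)
    refine sum_fderiv_adjugate_mulVec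
      (F := fun y => Matrix.of fun k l => fderiv ℝ χ y (Pi.single l 1) k)
      (F' := fun k l => (ContinuousLinearMap.proj k).comp
        ((fderiv ℝ (fderiv ℝ χ) x).flip (Pi.single l 1)))
      (fun k l => ?_) (hasFDerivAt_pi'.1 hw) (fun k l m => ?_)
      (Matrix.of fun j k => fderiv ℝ v (χ x) (Pi.single k 1) j) (fun j i => ?_)
    · have h := hχ'.clm_apply (hasFDerivAt_const (Pi.single l (1 : ℝ) : Fin 3 → ℝ) x)
      simpa using hasFDerivAt_pi'.1 h k
    · exact congrFun (hsymm (Pi.single m 1) (Pi.single l 1)) k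
    · have h := congrFun (LinearMap.pi_apply_eq_sum_univ (fderiv ℝ v (χ x)).toLinearMap
        (fderiv ℝ χ x (Pi.single i 1))) j
      have hs : ∀ k : Fin 3, (fun m => if k = m then (1 : ℝ) else 0) = Pi.single k 1 := fun k => by
        ext m
        simp [Pi.single_apply, eq_comm]
      simp only [hs, Finset.sum_apply, Pi.smul_apply, smul_eq_mul] at h
      exact h
  exact ⟨key, fun h x => by rw [key x, h (χ x), mul_zero]⟩
end

section
/- Let R : ℝ → ℝ be twice continuously differentiable with R(t) > 0 for all t, set a(t) := −R(t)² R'(t), and define, for y ∈ ℝ³ \ {0} and t ∈ ℝ, v(y,t) := −a(t) y/‖y‖³ and p(y,t) := −a'(t)/‖y‖ − a(t)²/(2‖y‖⁴). Then for every t and every y ≠ 0: (i) div_y v(·,t)(y) = 0; (ii) for every ν ∈ ℝ, ∂_t v(y,t) + (D_y v(y,t))(v(y,t)) = ν Δ_y v(y,t) − ∇_y p(y,t); and (iii) if ‖y‖ = R(t), then v(y,t) = (R'(t)/R(t)) y. -/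
noncomputable def aCoeff (R : ℝ → ℝ) (t : ℝ) : ℝ := -(R t) ^ 2 * deriv R t

noncomputable def vField (R : ℝ → ℝ) (y : EuclideanSpace ℝ (Fin 3)) (t : ℝ) :
    EuclideanSpace ℝ (Fin 3) :=
  (-(aCoeff R t) / ‖y‖ ^ 3) • y

noncomputable def pField (R : ℝ → ℝ) (y : EuclideanSpace ℝ (Fin 3)) (t : ℝ) : ℝ :=
  -(deriv (aCoeff R) t) / ‖y‖ - (aCoeff R t) ^ 2 / (2 * ‖y‖ ^ 4)

theorem hasFDerivAt_norm_of_ne_zero {E : Type*} [NormedAddCommGroup E] [InnerProductSpace ℝ E]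
    {z : E} (hz : z ≠ 0) : HasFDerivAt (fun w : E => ‖w‖) (‖z‖⁻¹ • innerSL ℝ z) z := by
  have hz' : ‖z‖ ≠ 0 := norm_ne_zero_iff.mpr hz
  have h := (hasStrictFDerivAt_norm_sq z).hasFDerivAt.sqrt (pow_ne_zero 2 hz')
  simp only [Real.sqrt_sq (norm_nonneg _)] at h
  refine h.congr_fderiv ?_
  ext w
  simp
  field_simp

theorem hasFDerivAt_const_div_norm_pow {E : Type*} [NormedAddCommGroup E] [InnerProductSpace ℝ E]
    (c : ℝ) (n : ℕ) {z : E} (hz : z ≠ 0) :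
    HasFDerivAt (fun w : E => c / ‖w‖ ^ n) ((-(n * c) / ‖z‖ ^ (n + 2)) • innerSL ℝ z) z := by
  have hz' : ‖z‖ ≠ 0 := norm_ne_zero_iff.mpr hz
  have hd : HasDerivAt (fun r : ℝ => c / r ^ n) (-(n * c) / ‖z‖ ^ (n + 1)) ‖z‖ := by
    refine ((hasDerivAt_const ‖z‖ c).fun_div (hasDerivAt_pow n ‖z‖)
      (pow_ne_zero n hz')).congr_deriv ?_
    rcases n with _ | n
    · simp
    · simp only [Nat.add_sub_cancel]
      field_simp
      ring
  refine (hd.comp_hasFDerivAt z (hasFDerivAt_norm_of_ne_zero hz)).congr_fderiv ?_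
  ext w
  simp
  field_simp
  ring

theorem hasFDerivAt_vField (R : ℝ → ℝ) (t : ℝ) {z : EuclideanSpace ℝ (Fin 3)} (hz : z ≠ 0) :
    HasFDerivAt (fun w => vField R w t)
      ((-(aCoeff R t) / ‖z‖ ^ 3) • ContinuousLinearMap.id ℝ (EuclideanSpace ℝ (Fin 3)) +
        ((3 * aCoeff R t / ‖z‖ ^ 5) • innerSL ℝ z).smulRight z) z := by
  refine ((hasFDerivAt_const_div_norm_pow (-(aCoeff R t)) 3 hz).fun_smul
    (hasFDerivAt_id z)).congr_fderiv ?_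
  simp

theorem fderiv_vField_apply (R : ℝ → ℝ) (t : ℝ) {z : EuclideanSpace ℝ (Fin 3)} (hz : z ≠ 0)
    (w : EuclideanSpace ℝ (Fin 3)) (i : Fin 3) :
    fderiv ℝ (fun w => vField R w t) z w i =
      -(aCoeff R t) / ‖z‖ ^ 3 * w i + 3 * aCoeff R t / ‖z‖ ^ 5 * (inner ℝ z w * z i) := by
  rw [(hasFDerivAt_vField R t hz).fderiv]
  simp
  ring

theorem norm_sq_eq_sum_three (y : EuclideanSpace ℝ (Fin 3)) :
    ‖y‖ ^ 2 = y 0 ^ 2 + y 1 ^ 2 + y 2 ^ 2 := by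
  simp [EuclideanSpace.norm_sq_eq, Fin.sum_univ_three]

theorem fderiv_fderiv_vField_apply (R : ℝ → ℝ) (t : ℝ) {y : EuclideanSpace ℝ (Fin 3)}
    (hy : y ≠ 0) (i j : Fin 3) :
    fderiv ℝ (fun z => fderiv ℝ (fun w => vField R w t) z (EuclideanSpace.single j 1) i)
        y (EuclideanSpace.single j 1) =
      3 * aCoeff R t / ‖y‖ ^ 5 *
          (2 * y j * (EuclideanSpace.single j (1 : ℝ) : EuclideanSpace ℝ (Fin 3)) i + y i) -
        15 * aCoeff R t / ‖y‖ ^ 7 * (y j ^ 2 * y i) := by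
  have hproj (k : Fin 3) : HasFDerivAt (fun z : EuclideanSpace ℝ (Fin 3) => z k)
      (EuclideanSpace.proj k : EuclideanSpace ℝ (Fin 3) →L[ℝ] ℝ) y :=
    (EuclideanSpace.proj k : EuclideanSpace ℝ (Fin 3) →L[ℝ] ℝ).hasFDerivAt
  have heq : (fun z => fderiv ℝ (fun w => vField R w t) z (EuclideanSpace.single j 1) i) =ᶠ[nhds y]
      fun z => -(aCoeff R t) / ‖z‖ ^ 3 *
          (EuclideanSpace.single j (1 : ℝ) : EuclideanSpace ℝ (Fin 3)) i +
        3 * aCoeff R t / ‖z‖ ^ 5 * (z j * z i) := by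
    filter_upwards [isOpen_ne.mem_nhds hy] with z hz
    rw [fderiv_vField_apply R t hz]
    simp [EuclideanSpace.inner_single_right]
  rw [heq.fderiv_eq, (((hasFDerivAt_const_div_norm_pow (-(aCoeff R t)) 3 hy).mul_const _).fun_add
    ((hasFDerivAt_const_div_norm_pow (3 * aCoeff R t) 5 hy).fun_mul
      ((hproj j).fun_mul (hproj i)))).fderiv]
  by_cases hij : i = j <;> simp [hij, EuclideanSpace.inner_single_right] <;> ring

theorem sum_fderiv_vField_single (R : ℝ → ℝ) (t : ℝ) {y : EuclideanSpace ℝ (Fin 3)}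
    (hy : y ≠ 0) :
    ∑ i : Fin 3, fderiv ℝ (fun z => vField R z t) y (EuclideanSpace.single i 1) i = 0 := by
  have hr : ‖y‖ ≠ 0 := norm_ne_zero_iff.mpr hy
  simp only [fderiv_vField_apply R t hy, Fin.sum_univ_three, EuclideanSpace.inner_single_right]
  simp
  field_simp
  rw [norm_sq_eq_sum_three]
  ring

theorem sum_fderiv_fderiv_vField (R : ℝ → ℝ) (t : ℝ) {y : EuclideanSpace ℝ (Fin 3)}
    (hy : y ≠ 0) (i : Fin 3) :
    ∑ j : Fin 3, fderiv ℝ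
        (fun z => fderiv ℝ (fun w => vField R w t) z (EuclideanSpace.single j 1) i)
        y (EuclideanSpace.single j 1) = 0 := by
  have hr : ‖y‖ ≠ 0 := norm_ne_zero_iff.mpr hy
  simp only [fderiv_fderiv_vField_apply R t hy]
  have hs : ∑ j : Fin 3, y j * (EuclideanSpace.single j (1 : ℝ) : EuclideanSpace ℝ (Fin 3)) i
      = y i := by
    simp
  rw [Fin.sum_univ_three] at hs ⊢
  have h : 3 * aCoeff R t / ‖y‖ ^ 5 = 3 * aCoeff R t / ‖y‖ ^ 7 * ‖y‖ ^ 2 := by field_simp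
  have hn := norm_sq_eq_sum_three y
  have e : 15 * aCoeff R t / ‖y‖ ^ 7 = 5 * (3 * aCoeff R t / ‖y‖ ^ 7) := by ring
  rw [h, e]
  linear_combination (3 * aCoeff R t / ‖y‖ ^ 7) * (2 * ‖y‖ ^ 2 * hs + 5 * y i * hn)

theorem fderiv_pField_single (R : ℝ → ℝ) (t : ℝ) {y : EuclideanSpace ℝ (Fin 3)}
    (hy : y ≠ 0) (i : Fin 3) :
    fderiv ℝ (fun z => pField R z t) y (EuclideanSpace.single i 1) =
      (deriv (aCoeff R) t / ‖y‖ ^ 3 + 2 * aCoeff R t ^ 2 / ‖y‖ ^ 6) * y i := by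
  have heq : (fun z => pField R z t) = fun z : EuclideanSpace ℝ (Fin 3) =>
      -(deriv (aCoeff R) t) / ‖z‖ ^ 1 - (aCoeff R t ^ 2 / 2) / ‖z‖ ^ 4 := by
    funext z
    rw [pField, pow_one, div_div]
  rw [heq, ((hasFDerivAt_const_div_norm_pow (-(deriv (aCoeff R) t)) 1 hy).fun_sub
    (hasFDerivAt_const_div_norm_pow (aCoeff R t ^ 2 / 2) 4 hy)).fderiv]
  simp [EuclideanSpace.inner_single_right]
  ring

theorem differentiable_aCoeff {R : ℝ → ℝ} (hR : ContDiff ℝ 2 R) :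
    Differentiable ℝ (aCoeff R) := by
  have h1 : Differentiable ℝ R := hR.differentiable (by norm_num)
  have h2 : Differentiable ℝ (deriv R) :=
    ((contDiff_succ_iff_deriv (n := 1)).mp hR).2.2.differentiable (by norm_num)
  unfold aCoeff
  fun_prop

theorem deriv_vField_apply {R : ℝ → ℝ} (hR : ContDiff ℝ 2 R)
    (y : EuclideanSpace ℝ (Fin 3)) (t : ℝ) (i : Fin 3) :
    deriv (fun s => vField R y s i) t = -(deriv (aCoeff R) t) / ‖y‖ ^ 3 * y i :=
  (((differentiable_aCoeff hR t).hasDerivAt.fun_neg.div_const (‖y‖ ^ 3)).mul_const (y i)).deriv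

theorem stmt_9 (R : ℝ → ℝ) (hR : ContDiff ℝ 2 R) (hRpos : ∀ t, 0 < R t)
    (y : EuclideanSpace ℝ (Fin 3)) (hy : y ≠ 0) (t : ℝ) :
    (∑ i : Fin 3, fderiv ℝ (fun z => vField R z t) y (EuclideanSpace.single i 1) i = 0) ∧
      (∀ ν : ℝ, ∀ i : Fin 3,
        deriv (fun s => vField R y s i) t
            + fderiv ℝ (fun z => vField R z t) y (vField R y t) i
          = ν * (∑ j : Fin 3,
                fderiv ℝ
                  (fun z => fderiv ℝ (fun w => vField R w t) z (EuclideanSpace.single j 1) i)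
                  y (EuclideanSpace.single j 1))
            - fderiv ℝ (fun z => pField R z t) y (EuclideanSpace.single i 1)) ∧
      (‖y‖ = R t → vField R y t = (deriv R t / R t) • y) := by
  have hr : ‖y‖ ≠ 0 := norm_ne_zero_iff.mpr hy
  refine ⟨sum_fderiv_vField_single R t hy, fun ν i => ?_, fun h => ?_⟩
  · rw [sum_fderiv_fderiv_vField R t hy, fderiv_pField_single R t hy,
      deriv_vField_apply hR, fderiv_vField_apply R t hy]
    simp only [vField, inner_smul_right, real_inner_self_eq_norm_sq, PiLp.smul_apply, smul_eq_mul]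
    field_simp
    ring
  · have hRt : R t ≠ 0 := (hRpos t).ne'
    rw [vField, h, aCoeff]
    congr 1
    field_simp
end

section
/- Let c ∈ ℝ and define v : ℝ³ \ {0} → ℝ³ by v(x) := −c x/‖x‖³. Let R > 0, ν ∈ ℝ, and let q : ℝ³ → ℝ be a function that is constant on the sphere S_R = {x ∈ ℝ³ : ‖x‖ = R}. Then ∫_{S_R} [ ν (Dv(x) + Dv(x)ᵀ) − q(x)·𝕀 ] · (x/R) dμH²(x) = 0; that is, the total traction exerted on S_R by the Cauchy stress of the pair (v, q) vanishes. -/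
open MeasureTheory

noncomputable def dipole (c : ℝ) (x : EuclideanSpace ℝ (Fin 3)) :
    EuclideanSpace ℝ (Fin 3) :=
  (-c / ‖x‖ ^ 3) • x

theorem dipole_neg (c : ℝ) (x : EuclideanSpace ℝ (Fin 3)) : dipole c (-x) = -dipole c x := by
  simp [dipole]

theorem fderiv_neg_of_odd {𝕜 E F : Type*} [NontriviallyNormedField 𝕜]
    [NormedAddCommGroup E] [NormedSpace 𝕜 E] [NormedAddCommGroup F] [NormedSpace 𝕜 F]
    {f : E → F} (hf : ∀ x, f (-x) = -f x) (x : E) : fderiv 𝕜 f (-x) = fderiv 𝕜 f x := by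
  have h := (ContinuousLinearEquiv.neg 𝕜 (M := E)).comp_right_fderiv (f := f) (x := x)
  have hcomp : f ∘ ContinuousLinearEquiv.neg 𝕜 (M := E) = -f := funext hf
  rw [hcomp, fderiv_neg] at h
  ext v
  simpa using (DFunLike.congr_fun h v).symm

/-- An odd function has zero integral over any centred sphere with respect to the Hausdorff
measure. -/
theorem setIntegral_sphere_hausdorffMeasure_eq_zero_of_odd {E F : Type*}
    [NormedAddCommGroup E] [MeasurableSpace E] [BorelSpace E]
    [NormedAddCommGroup F] [NormedSpace ℝ F] (d R : ℝ) {f : E → F}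
    (hf : ∀ x ∈ Metric.sphere (0 : E) R, f (-x) = -f x) :
    ∫ x in Metric.sphere (0 : E) R, f x ∂(μH[d]) = 0 := by
  have hmp := (IsometryEquiv.neg E).measurePreserving_hausdorffMeasure d
  have h := hmp.setIntegral_preimage_emb
    (IsometryEquiv.neg E).toHomeomorph.measurableEmbedding f (Metric.sphere 0 R)
  have hpre : (IsometryEquiv.neg E) ⁻¹' Metric.sphere 0 R = Metric.sphere 0 R := by
    ext x
    simp
  have hneg : ∫ x in Metric.sphere 0 R, f (IsometryEquiv.neg E x) ∂(μH[d]) =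
      ∫ x in Metric.sphere 0 R, -f x ∂(μH[d]) :=
    setIntegral_congr_fun Metric.isClosed_sphere.measurableSet hf
  rw [hpre, hneg, integral_neg] at h
  have : IsAddTorsionFree F := .of_isTorsionFree ℝ F
  exact neg_eq_self.mp h

theorem stmt_10 (c R ν : ℝ) (hR : 0 < R) (q : EuclideanSpace ℝ (Fin 3) → ℝ)
    (hq : ∀ x ∈ Metric.sphere (0 : EuclideanSpace ℝ (Fin 3)) R,
      ∀ y ∈ Metric.sphere (0 : EuclideanSpace ℝ (Fin 3)) R, q x = q y) :
    (∫ x in Metric.sphere (0 : EuclideanSpace ℝ (Fin 3)) R,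
        (ν • ((fderiv ℝ (dipole c) x
              + ContinuousLinearMap.adjoint (fderiv ℝ (dipole c) x)) (R⁻¹ • x))
          - q x • (R⁻¹ • x)) ∂(μH[2]))
      = 0 := by
  refine setIntegral_sphere_hausdorffMeasure_eq_zero_of_odd 2 R fun x hx => ?_
  rw [hq (-x) (by simpa using hx) x hx, fderiv_neg_of_odd (dipole_neg c)]
  simp only [smul_neg, map_neg]
  abel
end
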